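/- Let p ∈ [1,∞), let Ω ⊆ X be an open set, and let u ∈ L^p_loc(Ω). Then the set function E_p[u](·) — defined on open subsets of Ω by the relaxation with locally Lipschitz functions and extended to arbitrary subsets by infimum over open supersets — is a Borel-regular outer measure on Ω. -/

import Mathlib

open MeasureTheory Filter Metric Set Topology
open scoped ENNReal NNReal

noncomputable section

namespace BBM

variable {X : Type*} [MetricSpace X]

/-- The closed `r`-neighborhood of a set `S`: the set of points at distance at most `r`
from `S`. -/
def setBall (S : Set X) (r : ℝ) : Set X :=
  {x : X | EMetric.infEdist x S ≤ ENNReal.ofReal r}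

/-- The (extended) distance, computed in the metric completion `X̄` of `X`, from a set
`S ⊆ X` to the complement `X̄ \ S₀` of a set `S₀ ⊆ X`. -/
def compDist (S S₀ : Set X) : ℝ≥0∞ :=
  ⨅ (x : X) (_ : x ∈ S) (z : UniformSpace.Completion X)
    (_ : z ∉ (fun a : X => (a : UniformSpace.Completion X)) '' S₀),
    edist (x : UniformSpace.Completion X) z

/-- `S ⋐ S₀` : the set `S` is well contained in `S₀`, i.e. `S ⊆ S₀` and the distance
from `S` to `X̄ \ S₀` (computed in the completion `X̄`) is positive. -/
def WellInside (S S₀ : Set X) : Prop := S ⊆ S₀ ∧ 0 < compDist S S₀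

/-- The local Lipschitz constant (slope) of `u` at `x`, relative to the domain `Ω`.
If `x` is not a limit point of `Ω`, the filter below is trivial and the value is `0`. -/
def lipAt (Ω : Set X) (u : X → ℝ) (x : X) : ℝ≥0∞ :=
  Filter.limsup (fun x' => ENNReal.ofReal (|u x' - u x| / dist x' x)) (𝓝[Ω \ {x}] x)

/-- `u` is locally Lipschitz on `Ω`: each point of `Ω` has a closed ball inside `Ω`
on which `u` is Lipschitz. -/
def LocLipschitzOn (Ω : Set X) (u : X → ℝ) : Prop :=
  ∀ x ∈ Ω, ∃ r > 0, ∃ K : NNReal, closedBall x r ⊆ Ω ∧ LipschitzOnWith K u (closedBall x r)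

variable [MeasurableSpace X]

/-- `u ∈ L^p_loc(E)` : `u` is Borel and `p`-integrable near every point of `E`. -/
def MemLpLocOn (m : Measure X) (p : ℝ) (E : Set X) (u : X → ℝ) : Prop :=
  Measurable u ∧ ∀ x ∈ E, ∃ r > 0,
    ∫⁻ x' in E ∩ closedBall x r, ENNReal.ofReal |u x'| ^ p ∂m < ⊤

/-- Convergence of a sequence `v n` to `u` in `L^p_loc(E)`. -/
def TendstoLpLoc (m : Measure X) (p : ℝ) (E : Set X) (v : ℕ → X → ℝ) (u : X → ℝ) : Prop :=
  ∀ x ∈ E, ∃ r > 0,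
    Tendsto (fun n => ∫⁻ x' in E ∩ closedBall x r, ENNReal.ofReal |v n x' - u x'| ^ p ∂m)
      atTop (𝓝 0)

/-- Cheeger `p`-energy of a real valued function on an open set `Ω'`, defined by relaxation
along sequences of locally Lipschitz functions converging in `L^p_loc(Ω')`. -/
def cheegerOpen (m : Measure X) (p : ℝ) (u : X → ℝ) (Ω' : Set X) : ℝ≥0∞ :=
  ⨅ (v : ℕ → X → ℝ) (_ : ∀ n, LocLipschitzOn Ω' (v n)) (_ : TendstoLpLoc m p Ω' v u),
    Filter.liminf (fun n => ∫⁻ x in Ω', lipAt Ω' (v n) x ^ p ∂m) atTop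

/-- Cheeger `p`-energy of a real valued function on an arbitrary subset `S` of `Ω`:
infimum over open sets `Ω'` with `S ⊆ Ω' ⊆ Ω`. -/
def cheegerSet (m : Measure X) (p : ℝ) (Ω : Set X) (u : X → ℝ) (S : Set X) : ℝ≥0∞ :=
  ⨅ (Ω' : Set X) (_ : IsOpen Ω') (_ : Ω' ⊆ Ω) (_ : S ⊆ Ω'), cheegerOpen m p u Ω'

/-- `φ` is a bounded `1`-Lipschitz real function. -/
def BddLip1 {Y : Type*} [PseudoMetricSpace Y] (φ : Y → ℝ) : Prop :=
  (∃ C, ∀ y, |φ y| ≤ C) ∧ LipschitzWith 1 φ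

/-- `ν` is a Borel-regular outer measure: Borel sets are Carathéodory-measurable and every
set is contained in a Borel set with the same measure. -/
def IsBorelRegularOM (ν : OuterMeasure X) : Prop :=
  (∀ B : Set X, MeasurableSet B → ν.IsCaratheodory B) ∧
  ∀ S : Set X, ∃ B : Set X, MeasurableSet B ∧ S ⊆ B ∧ ν S = ν B

/-- `ν` is the Cheeger `p`-energy of the metric-space-valued map `f` on `Ω`: the least
Borel-regular outer measure dominating `S ↦ E_p[φ ∘ f](S)` for all bounded `1`-Lipschitz
`φ : Y → ℝ` and all `S ⊆ Ω`. -/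
def IsCheegerEnergy (m : Measure X) (p : ℝ) (Ω : Set X) {Y : Type*} [MetricSpace Y]
    (f : X → Y) (ν : OuterMeasure X) : Prop :=
  IsBorelRegularOM ν ∧
  (∀ S, S ⊆ Ω → ∀ φ : Y → ℝ, BddLip1 φ → cheegerSet m p Ω (φ ∘ f) S ≤ ν S) ∧
  ∀ ν' : OuterMeasure X, IsBorelRegularOM ν' →
    (∀ S, S ⊆ Ω → ∀ φ : Y → ℝ, BddLip1 φ → cheegerSet m p Ω (φ ∘ f) S ≤ ν' S) →
    ∀ S, S ⊆ Ω → ν S ≤ ν' S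

/-- `f ∈ 𝔅(E, Y)` : `f` is Borel (w.r.t. the Borel σ-algebra of `Y`) on `E` and essentially
separably valued on `E`. -/
def MemB (m : Measure X) (E : Set X) {Y : Type*} [MetricSpace Y] (f : X → Y) : Prop :=
  (@Measurable E Y _ (borel Y) fun x : E => f x) ∧
  ∃ N : Set X, N ⊆ E ∧ m N = 0 ∧ TopologicalSpace.IsSeparable (f '' (E \ N))

/-- `f ∈ L^p(E, Y)`. -/
def MemLpY (m : Measure X) (p : ℝ) (E : Set X) {Y : Type*} [MetricSpace Y] (f : X → Y) :
    Prop :=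
  MemB m E f ∧ ∃ y : Y, ∫⁻ x in E, edist (f x) y ^ p ∂m < ⊤

/-- `f ∈ L^p_loc(E, Y)`. -/
def MemLpLocY (m : Measure X) (p : ℝ) (E : Set X) {Y : Type*} [MetricSpace Y] (f : X → Y) :
    Prop :=
  MemB m E f ∧ ∃ y : Y, ∀ x ∈ E, ∃ r > 0,
    ∫⁻ x' in E ∩ closedBall x r, edist (f x') y ^ p ∂m < ⊤

/-- `f ∈ S^{1,p}(Ω, Y)` : `f ∈ 𝔅(Ω,Y)`, the Cheeger `p`-energy of `f` is finite on `Ω` and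
absolutely continuous with respect to `m` restricted to `Ω`. -/
def MemSobolevClass (m : Measure X) (p : ℝ) (Ω : Set X) {Y : Type*} [MetricSpace Y]
    (f : X → Y) : Prop :=
  MemB m Ω f ∧ ∃ ν : OuterMeasure X, IsCheegerEnergy m p Ω f ν ∧ ν Ω < ⊤ ∧
    ∀ S, S ⊆ Ω → m S = 0 → ν S = 0

/-- The doubling property on the `R`-neighborhood of `S`, at scales up to `R`. -/
def DoublingOn (m : Measure X) (C_D : NNReal) (S : Set X) (R : ℝ) : Prop :=
  ∀ x ∈ setBall S R, ∀ r : ℝ, 0 < r → r ≤ R →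
    0 < m (closedBall x (2 * r)) ∧
    m (closedBall x (2 * r)) ≤ (C_D : ℝ≥0∞) * m (closedBall x r) ∧
    m (closedBall x r) < ⊤

/-- `X` is internally doubling with constant `C_D`. -/
def InternallyDoubling (m : Measure X) (C_D : NNReal) : Prop :=
  1 ≤ C_D ∧ ∀ S : Set X, WellInside S univ → ∃ R > 0, DoublingOn m C_D S R

/-- The `p`-Poincaré property on the `R`-neighborhood of `S`, at scales up to `R`. -/
def PoincareOn (m : Measure X) (p C_P lam : ℝ) (S : Set X) (R : ℝ) : Prop :=
  (∀ x ∈ setBall S R, ∀ r : ℝ, 0 < r → r ≤ lam * R →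
      0 < m (closedBall x r) ∧ m (closedBall x r) < ⊤) ∧
  ∀ u : X → ℝ, (∃ K : NNReal, LipschitzWith K u) →
    ∀ x ∈ setBall S R, ∀ r : ℝ, 0 < r → r ≤ R →
      (m (closedBall x r))⁻¹ *
          ∫⁻ x' in closedBall x r,
            ENNReal.ofReal |u x' - ⨍ x'' in closedBall x r, u x'' ∂m| ∂m ≤
        ENNReal.ofReal (C_P * r) *
          ((m (closedBall x (lam * r)))⁻¹ *
              ∫⁻ x' in closedBall x (lam * r), lipAt univ u x' ^ p ∂m) ^ (1 / p)

/-- `X` supports an internal `p`-Poincaré inequality with constants `C_P`, `lam`. -/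
def InternalPoincare (m : Measure X) (p C_P lam : ℝ) : Prop :=
  0 < C_P ∧ 1 ≤ lam ∧ ∀ S : Set X, WellInside S univ → ∃ R > 0, PoincareOn m p C_P lam S R

/-- `σ(δ, x, r)` : supremum of `ρ δ x ·` outside the closed ball `B(x,r)` (zero if the
complement is empty). -/
def sigmaM (ρ : ℝ → X → X → NNReal) (δ : ℝ) (x : X) (r : ℝ) : ℝ≥0∞ :=
  ⨆ x' ∈ (closedBall x r)ᶜ, (ρ δ x x' : ℝ≥0∞)

/-- Absolute difference in `ℝ≥0∞`. -/
def eabs (a b : ℝ≥0∞) : ℝ≥0∞ := (a - b) ⊔ (b - a)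

/-- The quantities `Π_{L,k}(δ,x,r,h)`. -/
def PiL (m : Measure X) (ρ : ℝ → X → X → NNReal) (p δ : ℝ) (x : X) (r h : ℝ) : ℕ → ℝ≥0∞
  | 0 => sigmaM ρ δ x r * m (closedBall x (r / h)) * ENNReal.ofReal (r / h) ^ p
  | k + 1 =>
      eabs (sigmaM ρ δ x (r / h ^ (k + 1))) (sigmaM ρ δ x (r / h ^ k)) *
        m (closedBall x (r / h ^ (k + 2))) * ENNReal.ofReal (r / h ^ (k + 2)) ^ p

/-- The quantities `Π_{U,k}(δ,x,r,h)`. -/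
def PiU (m : Measure X) (ρ : ℝ → X → X → NNReal) (p δ : ℝ) (x : X) (r h : ℝ) : ℕ → ℝ≥0∞
  | 0 => sigmaM ρ δ x r * m (closedBall x r) * ENNReal.ofReal r ^ p
  | k + 1 =>
      eabs (sigmaM ρ δ x (r / h ^ (k + 1))) (sigmaM ρ δ x (r / h ^ k)) *
        m (closedBall x (r / h ^ (k + 1))) * ENNReal.ofReal (r / h ^ (k + 1)) ^ p

/-- The family `(ρ_δ)_{δ ∈ (0,1)}` is `p`-admissible with constant `C_M`. -/
def PAdmissible (m : Measure X) (p : ℝ) (ρ : ℝ → X → X → NNReal) (C_M : NNReal) : Prop :=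
  (∀ δ ∈ Ioo (0:ℝ) 1, Measurable fun q : X × X => ρ δ q.1 q.2) ∧
  (Filter.limsup (fun r : ℝ => Filter.limsup (fun δ : ℝ =>
      ⨆ x : X, ∫⁻ x' in (closedBall x r)ᶜ, ((ρ δ x x' : ℝ≥0∞) + (ρ δ x' x : ℝ≥0∞)) ∂m)
      (𝓝[>] (0:ℝ))) (𝓝[>] (0:ℝ)) = 0) ∧
  (∀ x : X, Filter.limsup (fun r : ℝ => Filter.limsup (fun δ : ℝ => sigmaM ρ δ x r)
      (𝓝[>] (0:ℝ))) (𝓝[>] (0:ℝ)) = 0) ∧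
  (∀ δ ∈ Ioo (0:ℝ) 1, ∀ x x₁ x₂ : X, dist x x₁ ≤ dist x x₂ → ρ δ x x₂ ≤ ρ δ x x₁) ∧
  (∀ x : X, ∀ δ ∈ Ioo (0:ℝ) 1,
      Filter.limsup (fun r : ℝ => sigmaM ρ δ x r * m (closedBall x r) * ENNReal.ofReal r ^ p)
        (𝓝[>] (0:ℝ)) = 0) ∧
  1 ≤ C_M ∧
  ∀ S : Set X, S.Nonempty → WellInside S univ →
    ((C_M : ℝ≥0∞))⁻¹ ≤ Filter.liminf (fun r : ℝ => Filter.liminf (fun δ : ℝ =>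
        ∑' k, ⨅ x ∈ S, PiL m ρ p δ x r 2 k) (𝓝[>] (0:ℝ))) (𝓝[>] (0:ℝ)) ∧
    Filter.limsup (fun r : ℝ => Filter.limsup (fun δ : ℝ =>
        ∑' k, ⨆ x ∈ S, PiU m ρ p δ x r 2 k) (𝓝[>] (0:ℝ))) (𝓝[>] (0:ℝ)) ≤ (C_M : ℝ≥0∞)

/-- The family `(ρ_δ)_{δ ∈ (0,1)}` is strongly `p`-admissible with constant `C_M` and
function `Θ`. -/
def StronglyPAdmissible (m : Measure X) (p : ℝ) (ρ : ℝ → X → X → NNReal) (C_M : NNReal)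
    (Θ : X → ℝ≥0∞) : Prop :=
  PAdmissible m p ρ C_M ∧
  (∀ S : Set X, S.Nonempty → WellInside S univ → ∀ h : ℝ, 1 < h →
      Filter.limsup (fun r : ℝ => Filter.limsup (fun δ : ℝ =>
          ∑' k, ⨆ x ∈ S, PiU m ρ p δ x r h k) (𝓝[>] (0:ℝ))) (𝓝[>] (0:ℝ)) < ⊤) ∧
  Measurable Θ ∧ (∀ x, Θ x < ⊤) ∧
  Filter.limsup (fun h : ℝ => essSup (fun x : X =>
      Filter.limsup (fun r : ℝ => Filter.limsup (fun δ : ℝ =>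
          eabs (Θ x) (∑' k, PiL m ρ p δ x r h k) + eabs (Θ x) (∑' k, PiU m ρ p δ x r h k))
        (𝓝[>] (0:ℝ))) (𝓝[>] (0:ℝ))) m) (𝓝[>] (1:ℝ)) = 0

/-- The Korevaar–Schoen approximate `p`-energy density `ks_p[f,E](x,r)`. -/
def ks (m : Measure X) (p : ℝ) {Y : Type*} [PseudoEMetricSpace Y] (f : X → Y) (E : Set X)
    (x : X) (r : ℝ) : ℝ≥0∞ :=
  (m (closedBall x r))⁻¹ *
    ∫⁻ x' in closedBall x r ∩ E, edist (f x) (f x') ^ p / ENNReal.ofReal r ^ p ∂m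

/-- The averaging operator `A_p[f](x,r)` applied to an energy (outer) measure `ν`. -/
def Aop (m : Measure X) (ν : OuterMeasure X) (x : X) (r : ℝ) : ℝ≥0∞ :=
  if m (closedBall x r) = 0 then 0 else ν (closedBall x r) / m (closedBall x r)

/-- The (modified) Riesz potential `R_p[f](x,r)` applied to an energy measure `ν`. -/
def Rop (m : Measure X) (ν : OuterMeasure X) (x : X) (r : ℝ) : ℝ≥0∞ :=
  (3 : ℝ≥0∞)⁻¹ * ∑' k : ℕ, (2 / 3 : ℝ≥0∞) ^ k * Aop m ν x (r / 2 ^ k)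

/-- The maximal function `M_p[f](x,r)` applied to an energy measure `ν`. -/
def Mop (m : Measure X) (ν : OuterMeasure X) (x : X) (r : ℝ) : ℝ≥0∞ :=
  ⨆ r' ∈ Ioc (0:ℝ) r, Aop m ν x r'

/-- `x` is a density point of `E` (and lies in the support of `m`). -/
def IsDensityPoint (m : Measure X) (E : Set X) (x : X) : Prop :=
  (∀ r : ℝ, 0 < r → 0 < m (ball x r)) ∧
  Tendsto (fun r : ℝ => m (E ∩ closedBall x r) / m (closedBall x r)) (𝓝[>] (0:ℝ)) (𝓝 1)

/-- `f` has the Luzin–Lipschitz property on `E`. -/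
def LuzinLipschitzOn (m : Measure X) (E : Set X) {Y : Type*} [PseudoEMetricSpace Y]
    (f : X → Y) : Prop :=
  ∃ E' : ℕ → Set X, (∀ k, MeasurableSet (E' k) ∧ E' k ⊆ E) ∧ m (E \ ⋃ k, E' k) = 0 ∧
    ∀ k, ∃ K : NNReal, LipschitzOnWith K f (E' k)

/-- A strongly rectifiable atlas with accuracy `ε`: pieces `U i`, dimensions `d i`,
`(1+ε)`-biLipschitz charts `ψ i`, and pushforward measures equal to `c i · θ i · Lebesgue`
on the chart images. -/
def RectAtlas (m : Measure X) (ε : ℝ) (d : ℕ → ℕ) (U : ℕ → Set X)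
    (ψ : (i : ℕ) → X → EuclideanSpace ℝ (Fin (d i))) (c : ℕ → ℝ)
    (θ : (i : ℕ) → EuclideanSpace ℝ (Fin (d i)) → ℝ) : Prop :=
  (∀ i, MeasurableSet (U i)) ∧ Pairwise (Function.onFun Disjoint U) ∧
  m (Set.univ \ ⋃ i, U i) = 0 ∧
  (∀ i, ∀ x ∈ U i, ∀ y ∈ U i,
      dist x y ≤ (1 + ε) * dist (ψ i x) (ψ i y) ∧ dist (ψ i x) (ψ i y) ≤ (1 + ε) * dist x y) ∧
  (∀ i, 0 < c i) ∧ (∀ i, Measurable (θ i)) ∧ (∀ i v, θ i v ∈ Set.Icc (1 + ε)⁻¹ (1 + ε)) ∧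
  ∀ i, ∀ A : Set (EuclideanSpace ℝ (Fin (d i))), MeasurableSet A →
    m (U i ∩ ψ i ⁻¹' A) = ∫⁻ v in A ∩ ψ i '' U i, ENNReal.ofReal (c i * θ i v)

/-- `X` (with measure `m`) is strongly rectifiable. -/
def StronglyRectifiable (m : Measure X) : Prop :=
  ∀ ε ∈ Ioo (0:ℝ) 1, ∃ d U ψ c θ, RectAtlas m ε d U ψ c θ

/-- `Dim` is a dimensional decomposition function for the strongly rectifiable space `X`. -/
def IsDimensionFunction (m : Measure X) (Dim : X → ℕ) : Prop :=
  Measurable Dim ∧ ∀ ε ∈ Ioo (0:ℝ) 1, ∃ d U ψ c θ, RectAtlas m ε d U ψ c θ ∧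
    ∀ i, m {x ∈ U i | Dim x ≠ d i} = 0

/-- The data of a good extension: `ι` is an isometric embedding of `Y` into `Z` and
`F ∈ L^p(X, Z)` has finite Cheeger `p`-energy `ν` on `X`, coincides `m`-a.e. on `Ω`
with `ι ∘ f`, and `E_p[F](B(Ω,r)) → E_p[F](Ω)` as `r ↘ 0`. -/
def IsGoodExtension (m : Measure X) (p : ℝ) (Ω : Set X) {Y : Type*} [MetricSpace Y]
    {Z : Type*} [MetricSpace Z] (f : X → Y) (ι : Y → Z) (F : X → Z) : Prop :=
  Isometry ι ∧ MemLpY m p Set.univ F ∧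
  ∃ ν : OuterMeasure X, IsCheegerEnergy m p Set.univ F ν ∧ ν Set.univ < ⊤ ∧
    (∀ᵐ x ∂m.restrict Ω, F x = ι (f x)) ∧
    Tendsto (fun r : ℝ => ν (setBall Ω r)) (𝓝[>] (0:ℝ)) (𝓝 (ν Ω))

/-- The open set `Ω` has the strong `p`-extension property. -/
def StrongPExtension (m : Measure X) (p : ℝ) (Ω : Set X) : Prop :=
  ∀ (Y : Type) [MetricSpace Y] (f : X → Y),
    MemLpY m p Ω f → (∃ ν : OuterMeasure X, IsCheegerEnergy m p Ω f ν ∧ ν Ω < ⊤) →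
    ∃ (Z : Type) (iZ : MetricSpace Z) (ι : Y → Z) (F : X → Z),
      @IsGoodExtension X _ _ m p Ω Y _ Z iZ f ι F


section helpers

lemma lipAt_eq_of_mem {X : Type*} [MetricSpace X] {Ω : Set X} {x : X} (h : Ω ∈ 𝓝 x) (v : X → ℝ) :
    lipAt Ω v x =
      Filter.limsup (fun x' => ENNReal.ofReal (|v x' - v x| / dist x' x)) (𝓝[≠] x) := by
  unfold lipAt
  have : 𝓝[Ω \ {x}] x = 𝓝[≠] x := by
    rw [sdiff_eq]
    exact nhdsWithin_inter_of_mem (mem_nhdsWithin_of_mem_nhds h)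
  rw [this]

lemma lipAt_congr {X : Type*} [MetricSpace X] {Ω Ω' : Set X} {x : X} (h : Ω ∈ 𝓝 x)
    (h' : Ω' ∈ 𝓝 x) (v : X → ℝ) : lipAt Ω v x = lipAt Ω' v x := by
  rw [lipAt_eq_of_mem h, lipAt_eq_of_mem h']

lemma lipAt_le {X : Type*} [MetricSpace X] {Ω : Set X} {x : X} (h : Ω ∈ 𝓝 x) {v : X → ℝ} {L : ℝ}
    (hL : ∀ ε > 0, ∀ᶠ y in 𝓝 x, |v y - v x| ≤ (L + ε) * dist y x) :
    lipAt Ω v x ≤ ENNReal.ofReal L := by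
  rw [lipAt_eq_of_mem h]
  have key : ∀ ε > 0, Filter.limsup (fun x' => ENNReal.ofReal (|v x' - v x| / dist x' x)) (𝓝[≠] x)
      ≤ ENNReal.ofReal (L + ε) := by
    intro ε hε
    refine Filter.limsup_le_of_le (by isBoundedDefault) ?_
    filter_upwards [mem_nhdsWithin_of_mem_nhds (hL ε hε), self_mem_nhdsWithin] with y hy hyx
    apply ENNReal.ofReal_le_ofReal
    rw [div_le_iff₀ (dist_pos.2 hyx)]
    exact hy
  have ht : Tendsto (fun ε : ℝ => ENNReal.ofReal (L + ε)) (𝓝[>] 0) (𝓝 (ENNReal.ofReal L)) := by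
    have : Tendsto (fun ε : ℝ => ENNReal.ofReal (L + ε)) (𝓝 0) (𝓝 (ENNReal.ofReal (L + 0))) :=
      (ENNReal.continuous_ofReal.comp (continuous_const.add continuous_id)).tendsto _
    rw [add_zero] at this
    exact this.mono_left nhdsWithin_le_nhds
  exact ge_of_tendsto ht (by filter_upwards [self_mem_nhdsWithin] with ε hε using key ε hε)

lemma eventually_of_lipAt {X : Type*} [MetricSpace X] {Ω : Set X} {x : X} (h : Ω ∈ 𝓝 x)
    {v : X → ℝ} (hv : lipAt Ω v x ≠ ⊤) {ε : ℝ} (hε : 0 < ε) :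
    ∀ᶠ y in 𝓝 x, |v y - v x| ≤ ((lipAt Ω v x).toReal + ε) * dist y x := by
  have h1 : lipAt Ω v x < ENNReal.ofReal ((lipAt Ω v x).toReal + ε) := by
    rw [← ENNReal.ofReal_toReal hv]
    refine (ENNReal.ofReal_lt_ofReal_iff (by positivity)).2 ?_
    rw [ENNReal.toReal_ofReal (by positivity)]
    linarith
  set L := (lipAt Ω v x).toReal
  rw [lipAt_eq_of_mem h] at h1
  have h2 := Filter.eventually_lt_of_limsup_lt h1 (by isBoundedDefault)
  rw [eventually_nhdsWithin_iff] at h2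
  filter_upwards [h2] with y hy
  by_cases hyx : y = x
  · simp [hyx]
  have h3 := hy hyx
  have h4 := (ENNReal.ofReal_lt_ofReal_iff_of_nonneg (by positivity)).1 h3
  rw [div_lt_iff₀ (dist_pos.2 hyx)] at h4
  exact h4.le

lemma lipAt_lt_top {X : Type*} [MetricSpace X] {Ω : Set X} {v : X → ℝ} (hΩ : IsOpen Ω)
    (hv : LocLipschitzOn Ω v) {x : X} (hx : x ∈ Ω) : lipAt Ω v x ≠ ⊤ := by
  obtain ⟨r, hr, K, hsub, hK⟩ := hv x hx
  refine ne_top_of_le_ne_top (ENNReal.ofReal_ne_top (r := (K:ℝ))) (lipAt_le (hΩ.mem_nhds hx) ?_)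
  intro ε hε
  filter_upwards [closedBall_mem_nhds x hr] with y hy
  have := hK.dist_le_mul y hy x (mem_closedBall_self hr.le)
  rw [Real.dist_eq] at this
  have h0 : 0 ≤ dist y x := dist_nonneg
  nlinarith

lemma LocLipschitzOn.continuousOn {X : Type*} [MetricSpace X] {Ω : Set X} {v : X → ℝ}
    (hv : LocLipschitzOn Ω v) : ContinuousOn v Ω := by
  intro x hx
  obtain ⟨r, hr, K, hsub, hK⟩ := hv x hx
  exact (hK.continuousOn.continuousAt (closedBall_mem_nhds x hr)).continuousWithinAt

lemma locLipschitzOn_of {X : Type*} [MetricSpace X] {Ω : Set X} {v : X → ℝ} (hΩ : IsOpen Ω)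
    (h : ∀ x ∈ Ω, ∃ K : ℝ≥0, ∃ t ∈ 𝓝 x, LipschitzOnWith K v t) : LocLipschitzOn Ω v := by
  intro x hx
  obtain ⟨K, t, ht, hK⟩ := h x hx
  obtain ⟨r, hr, hsub⟩ := Metric.nhds_basis_closedBall.mem_iff.1
    (Filter.inter_mem (hΩ.mem_nhds hx) ht)
  exact ⟨r, hr, K, hsub.trans inter_subset_left, hK.mono (hsub.trans inter_subset_right)⟩

lemma LocLipschitzOn.mono {X : Type*} [MetricSpace X] {Ω Ω' : Set X} {v : X → ℝ}
    (hv : LocLipschitzOn Ω v) (hΩ' : IsOpen Ω') (h : Ω' ⊆ Ω) : LocLipschitzOn Ω' v := by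
  refine locLipschitzOn_of hΩ' fun x hx => ?_
  obtain ⟨r, hr, K, hsub, hK⟩ := hv x (h hx)
  exact ⟨K, _, closedBall_mem_nhds x hr, hK⟩

lemma measurable_lipAt {X : Type*} [MetricSpace X] [MeasurableSpace X] [BorelSpace X]
    {Ω : Set X} {v : X → ℝ} (hΩ : IsOpen Ω) (hv : ContinuousOn v Ω) :
    Measurable (Ω.indicator (lipAt Ω v)) := by
  let F : ℕ → X → ℝ≥0∞ := fun n x => ⨆ x' ∈ ball x (1 / ((n:ℝ) + 1)) ∩ (Ω \ {x}),
    ENNReal.ofReal (|v x' - v x| / dist x' x)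
  have hF : ∀ x, lipAt Ω v x = ⨅ n, F n x := by
    intro x
    have hb : (𝓝[Ω \ {x}] x).HasBasis (fun _ : ℕ => True)
        (fun n : ℕ => ball x (1 / ((n:ℝ) + 1)) ∩ (Ω \ {x})) :=
      nhdsWithin_hasBasis (Metric.nhds_basis_ball_inv_nat_succ (x := x)) _
    unfold lipAt
    rw [hb.limsup_eq_iInf_iSup]
    simp [F]
  have hFm : ∀ n, Measurable (Ω.indicator (F n)) := by
    intro n
    refine measurable_of_Ioi fun c => ?_
    have : IsOpen (Ω.indicator (F n) ⁻¹' Ioi c) := by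
      rw [isOpen_iff_mem_nhds]
      intro x hx
      have hxΩ : x ∈ Ω := by
        by_contra hcon
        simp [indicator_of_notMem hcon] at hx
      simp only [mem_preimage, indicator_of_mem hxΩ, mem_Ioi, F, lt_iSup_iff] at hx
      obtain ⟨x', hx', hc⟩ := hx
      have hne : x' ≠ x := hx'.2.2
      have hcx : ContinuousAt v x := hv.continuousAt (hΩ.mem_nhds hxΩ)
      have hca : ContinuousAt (fun y => ENNReal.ofReal (|v x' - v y| / dist x' y)) x := by
        refine ENNReal.continuous_ofReal.continuousAt.comp ?_
        refine ContinuousAt.div ?_ ?_ (dist_ne_zero.2 hne)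
        · exact (continuousAt_const.sub hcx).abs
        · exact continuousAt_const.dist continuousAt_id
      have hball : ∀ᶠ y in 𝓝 x, dist x' y < 1 / ((n:ℝ) + 1) := by
        have : ContinuousAt (fun y => dist x' y) x := continuousAt_const.dist continuousAt_id
        exact this.eventually_lt_const (mem_ball.1 hx'.1)
      filter_upwards [hΩ.mem_nhds hxΩ, hca.eventually_const_lt hc, hball,
        isOpen_ne.mem_nhds hne.symm] with y hyΩ hyc hyb hyne
      simp only [mem_preimage, indicator_of_mem hyΩ, mem_Ioi, F, lt_iSup_iff]
      exact ⟨x', ⟨mem_ball.2 hyb, hx'.2.1, fun h => hyne h.symm⟩, hyc⟩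
    exact this.measurableSet
  have : Ω.indicator (lipAt Ω v) = fun x => ⨅ n, Ω.indicator (F n) x := by
    funext x
    by_cases hx : x ∈ Ω
    · simp [hx, hF]
    · simp [hx]
  rw [this]
  exact Measurable.iInf hFm

lemma lintegral_tsum_rpow_le {X : Type*} [MeasurableSpace X] (μ : Measure X) {p : ℝ} (hp : 1 ≤ p)
    {g : ℕ → X → ℝ≥0∞} (hg : ∀ k, Measurable (g k)) :
    ∫⁻ x, (∑' k, g k x) ^ p ∂μ ≤ (∑' k, (∫⁻ x, g k x ^ p ∂μ) ^ (1 / p)) ^ p := by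
  have hp0 : 0 < p := by linarith
  have hfin : ∀ n : ℕ, (∫⁻ x, (∑ k ∈ Finset.range n, g k x) ^ p ∂μ) ^ (1 / p)
      ≤ ∑ k ∈ Finset.range n, (∫⁻ x, g k x ^ p ∂μ) ^ (1 / p) := by
    intro n
    induction n with
    | zero => simp [hp0]
    | succ n ih =>
      simp only [Finset.sum_range_succ]
      refine le_trans ?_ (add_le_add_left ih _)
      exact ENNReal.lintegral_Lp_add_le (f := fun x => ∑ k ∈ Finset.range n, g k x)
        (Finset.measurable_sum _ fun k _ => hg k).aemeasurable (hg n).aemeasurable hp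
  have hfin' : ∀ n : ℕ, ∫⁻ x, (∑ k ∈ Finset.range n, g k x) ^ p ∂μ
      ≤ (∑' k, (∫⁻ x, g k x ^ p ∂μ) ^ (1 / p)) ^ p := by
    intro n
    rw [← ENNReal.rpow_inv_le_iff hp0, ← one_div]
    exact (hfin n).trans (ENNReal.sum_le_tsum _)
  refine le_of_tendsto' (lintegral_tendsto_of_tendsto_of_monotone (μ := μ)
    (f := fun n x => (∑ k ∈ Finset.range n, g k x) ^ p) ?_ ?_ ?_) hfin'
  · intro n
    exact ((Finset.measurable_sum _ fun k _ => hg k).pow_const p).aemeasurable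
  · refine Filter.Eventually.of_forall fun x => ?_
    intro a b hab
    exact ENNReal.rpow_le_rpow (Finset.sum_le_sum_of_subset (by simpa using hab)) hp0.le
  · refine Filter.Eventually.of_forall fun x => ?_
    exact (ENNReal.continuous_rpow_const.tendsto _).comp (ENNReal.tendsto_nat_tsum _)

lemma exists_pou {X : Type*} [MetricSpace X] (c : ℕ → X) (r : ℕ → ℝ) (hr : ∀ k, 0 < r k) :
    ∃ (φ : ℕ → X → ℝ) (C : ℕ → ℝ≥0), (∀ k, 1 ≤ C k) ∧ (∀ k, LipschitzWith (C k) (φ k)) ∧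
      (∀ k x, 0 ≤ φ k x) ∧ (∀ k x, φ k x ≤ 1) ∧
      (∀ k x, x ∉ closedBall (c k) (r k) → φ k x = 0) ∧
      (∀ n x, ∑ k ∈ Finset.range n, φ k x ≤ 1) ∧
      (∀ j, ∀ x ∈ ball (c j) (r j / 2), ∑ k ∈ Finset.range (j + 1), φ k x = 1) ∧
      (∀ j, ∀ x ∈ ball (c j) (r j / 2), ∀ k, j < k → φ k x = 0) := by
  let f : ℕ → X → ℝ := fun k x => max 0 (min 1 (2 - 2 / r k * dist x (c k)))
  have hf0 : ∀ k x, 0 ≤ f k x := fun k x => le_max_left _ _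
  have hf1 : ∀ k x, f k x ≤ 1 := fun k x => max_le zero_le_one (min_le_left _ _)
  have hfL : ∀ k, ∀ x y, |f k x - f k y| ≤ 2 / r k * dist x y := by
    intro k x y
    have hpos : 0 < 2 / r k := div_pos two_pos (hr k)
    have h1 : |f k x - f k y| ≤
        |(2 - 2 / r k * dist x (c k)) - (2 - 2 / r k * dist y (c k))| := by
      have h0 := abs_max_sub_max_le_max 0 (min 1 (2 - 2 / r k * dist x (c k))) 0
        (min 1 (2 - 2 / r k * dist y (c k)))
      refine h0.trans ?_
      rw [sub_self, abs_zero]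
      refine max_le (abs_nonneg _) ?_
      have := abs_min_sub_min_le_max 1 (2 - 2 / r k * dist x (c k)) 1 (2 - 2 / r k * dist y (c k))
      simpa using this
    refine h1.trans ?_
    have h2 : (2 - 2 / r k * dist x (c k)) - (2 - 2 / r k * dist y (c k))
      = 2 / r k * (dist y (c k) - dist x (c k)) := by ring
    rw [h2, abs_mul, abs_of_pos hpos]
    refine mul_le_mul_of_nonneg_left ?_ hpos.le
    rw [dist_comm x y]
    exact abs_dist_sub_le _ _ _
  let P : ℕ → X → ℝ := fun n x => ∏ i ∈ Finset.range n, (1 - f i x)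
  have hP0 : ∀ n x, 0 ≤ P n x := fun n x => Finset.prod_nonneg fun i _ => by linarith [hf1 i x]
  have hP1 : ∀ n x, P n x ≤ 1 := fun n x =>
    Finset.prod_le_one (fun i _ => by linarith [hf1 i x]) fun i _ => by linarith [hf0 i x]
  have hPs : ∀ n x, P (n + 1) x = P n x * (1 - f n x) := fun n x => Finset.prod_range_succ _ _
  have hPL : ∀ n, ∃ D : ℝ, 0 ≤ D ∧ ∀ x y, |P n x - P n y| ≤ D * dist x y := by
    intro n
    induction n with
    | zero => exact ⟨0, le_rfl, fun x y => by simp [P]⟩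
    | succ n ih =>
      obtain ⟨D, hD, h⟩ := ih
      have hpos : 0 < 2 / r n := div_pos two_pos (hr n)
      refine ⟨D + 2 / r n, by positivity, fun x y => ?_⟩
      rw [hPs, hPs]
      have e : P n x * (1 - f n x) - P n y * (1 - f n y)
        = (P n x - P n y) * (1 - f n x) + P n y * (f n y - f n x) := by ring
      rw [e]
      refine (abs_add_le _ _).trans ?_
      rw [abs_mul, abs_mul, add_mul, abs_sub_comm (f n y)]
      have a1 : |1 - f n x| ≤ 1 := abs_le.2 ⟨by linarith [hf1 n x], by linarith [hf0 n x]⟩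
      have a2 : |P n y| ≤ 1 := abs_le.2 ⟨by linarith [hP0 n y], hP1 n y⟩
      refine add_le_add ?_ ?_
      · exact (mul_le_of_le_one_right (abs_nonneg _) a1).trans (h x y)
      · exact (mul_le_of_le_one_left (abs_nonneg _) a2).trans (hfL n x y)
  choose D hD0 hD using hPL
  have hPz : ∀ j, ∀ x ∈ ball (c j) (r j / 2), ∀ n, j < n → P n x = 0 := by
    intro j x hx n hn
    refine Finset.prod_eq_zero (Finset.mem_range.2 hn) ?_
    have h1 : 2 / r j * dist x (c j) ≤ 1 := by
      have := mem_ball.1 hx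
      have hrj := hr j
      rw [div_mul_eq_mul_div, div_le_one hrj]
      linarith
    have : f j x = 1 := by
      simp only [f]
      rw [min_eq_left (by linarith), max_eq_right zero_le_one]
    rw [this, sub_self]
  have hsum : ∀ n x, ∑ k ∈ Finset.range n, (P k x - P (k + 1) x) = 1 - P n x := by
    intro n x
    rw [Finset.sum_range_sub']
    simp [P]
  refine ⟨fun k x => P k x - P (k + 1) x, fun k => Real.toNNReal (1 + D k + D (k + 1)), ?_, ?_, ?_, ?_, ?_, ?_, ?_, ?_⟩
  · intro k
    have h1 := hD0 k
    have h2 := hD0 (k+1)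
    rw [Real.one_le_toNNReal]
    linarith
  · intro k
    refine LipschitzWith.of_dist_le_mul fun x y => ?_
    rw [Real.dist_eq]
    have hd1 := hD0 k
    have hd2 := hD0 (k+1)
    rw [Real.coe_toNNReal _ (by positivity)]
    have e : (P k x - P (k + 1) x) - (P k y - P (k + 1) y)
      = (P k x - P k y) - (P (k + 1) x - P (k + 1) y) := by ring
    rw [e]
    have := abs_sub (P k x - P k y) (P (k + 1) x - P (k + 1) y)
    have h1 := hD k x y
    have h2 := hD (k+1) x y
    have h0 : 0 ≤ dist x y := dist_nonneg
    nlinarith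
  · intro k x
    show 0 ≤ P k x - P (k + 1) x
    rw [hPs]
    have := mul_nonneg (hP0 k x) (hf0 k x)
    linarith
  · intro k x
    show P k x - P (k + 1) x ≤ 1
    linarith [hP0 (k+1) x, hP1 k x]
  · intro k x hx
    show P k x - P (k + 1) x = 0
    rw [mem_closedBall, not_le] at hx
    have h1 : 2 < 2 / r k * dist x (c k) := by
      have hrj := hr k
      rw [div_mul_eq_mul_div, lt_div_iff₀ hrj]
      linarith
    have : f k x = 0 := by
      simp only [f]
      rw [min_eq_right (by linarith), max_eq_left (by linarith)]
    rw [hPs, this]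
    ring
  · intro n x
    show ∑ k ∈ Finset.range n, (P k x - P (k + 1) x) ≤ 1
    rw [hsum]
    linarith [hP0 n x]
  · intro j x hx
    show ∑ k ∈ Finset.range (j + 1), (P k x - P (k + 1) x) = 1
    rw [hsum, hPz j x hx _ (Nat.lt_succ_self j), sub_zero]
  · intro j x hx k hk
    show P k x - P (k + 1) x = 0
    rw [hPz j x hx k hk, hPz j x hx (k + 1) (by omega), sub_zero]

lemma lipschitzOn_mul_near {X : Type*} [MetricSpace X] {φ v : X → ℝ} {C : ℝ≥0}
    (hφ : LipschitzWith C φ) (h1 : ∀ x, |φ x| ≤ 1) {x : X}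
    (hv : ∃ K : ℝ≥0, ∃ t ∈ 𝓝 x, LipschitzOnWith K v t) :
    ∃ K : ℝ≥0, ∃ t ∈ 𝓝 x, LipschitzOnWith K (fun y => φ y * v y) t := by
  obtain ⟨K, t, ht, hK⟩ := hv
  have hc : ContinuousAt v x := hK.continuousOn.continuousAt ht
  have hb : ∀ᶠ y in 𝓝 x, |v y| < |v x| + 1 :=
    (hc.abs).eventually_lt_const (by linarith)
  refine ⟨K + C * Real.toNNReal (|v x| + 1), t ∩ {y | |v y| < |v x| + 1},
    Filter.inter_mem ht hb, LipschitzOnWith.of_dist_le_mul fun y hy z hz => ?_⟩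
  have hk := hK.dist_le_mul y hy.1 z hz.1
  have hφ' := hφ.dist_le_mul y z
  rw [Real.dist_eq] at hk hφ' ⊢
  have e : φ y * v y - φ z * v z = φ y * (v y - v z) + (φ y - φ z) * v z := by ring
  rw [e]
  refine (abs_add_le _ _).trans ?_
  rw [abs_mul, abs_mul]
  have hz2 : |v z| ≤ |v x| + 1 := le_of_lt hz.2
  have hpos : 0 ≤ |v x| + 1 := by positivity
  rw [NNReal.coe_add, NNReal.coe_mul, Real.coe_toNNReal _ hpos, add_mul]
  refine add_le_add ?_ ?_
  · exact (mul_le_of_le_one_left (abs_nonneg _) (h1 y)).trans hk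
  · calc |φ y - φ z| * |v z| ≤ (C * dist y z) * (|v x| + 1) :=
        mul_le_mul hφ' hz2 (abs_nonneg _) (by positivity)
      _ = _ := by ring

lemma lipschitzOn_sum_near {X : Type*} [MetricSpace X] {f : ℕ → X → ℝ} {x : X}
    (hf : ∀ k, ∃ K : ℝ≥0, ∃ t ∈ 𝓝 x, LipschitzOnWith K (f k) t) (n : ℕ) :
    ∃ K : ℝ≥0, ∃ t ∈ 𝓝 x, LipschitzOnWith K (fun y => ∑ k ∈ Finset.range n, f k y) t := by
  induction n with
  | zero => exact ⟨0, univ, univ_mem, by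
      refine LipschitzOnWith.of_dist_le_mul fun y _ z _ => ?_
      simp⟩
  | succ n ih =>
    obtain ⟨K, t, ht, hK⟩ := ih
    obtain ⟨K', t', ht', hK'⟩ := hf n
    refine ⟨K + K', t ∩ t', Filter.inter_mem ht ht', ?_⟩
    simp only [Finset.sum_range_succ]
    exact (hK.mono inter_subset_left).add (hK'.mono inter_subset_right)

/-- One-term estimate for the gluing lemma. -/
lemma glue_term {X : Type*} [MetricSpace X] {φ v : X → ℝ} {C : ℝ≥0} {O : Set X} (hO : IsOpen O)
    (hφ : LipschitzWith C φ) (h0 : ∀ x, 0 ≤ φ x) (h1 : ∀ x, φ x ≤ 1)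
    (hv : LocLipschitzOn O v) {x : X} (hx : x ∈ O) (c : ℝ) {ε : ℝ} (hε : 0 < ε) :
    ∀ᶠ y in 𝓝 x, |φ y * v y - φ x * v x - (φ y - φ x) * c| ≤
      (φ x * (lipAt O v x).toReal + C * |v x - c| + ε) * dist y x := by
  set L := (lipAt O v x).toReal with hL
  have hL0 : 0 ≤ L := ENNReal.toReal_nonneg
  have e1 := eventually_of_lipAt (hO.mem_nhds hx) (lipAt_lt_top hO hv hx) (half_pos hε)
  have hc : ContinuousAt (fun y => φ y * (L + ε / 2)) x :=
    (hφ.continuous.continuousAt).mul continuousAt_const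
  have e2 : ∀ᶠ y in 𝓝 x, φ y * (L + ε / 2) < φ x * L + ε := by
    refine hc.eventually_lt_const ?_
    nlinarith [h0 x, h1 x]
  filter_upwards [e1, e2] with y hy1 hy2
  have e : φ y * v y - φ x * v x - (φ y - φ x) * c
    = φ y * (v y - v x) + (φ y - φ x) * (v x - c) := by ring
  rw [e]
  refine (abs_add_le _ _).trans ?_
  rw [abs_mul, abs_mul, abs_of_nonneg (h0 y)]
  have hφ' := hφ.dist_le_mul y x
  rw [Real.dist_eq] at hφ'
  have hd : 0 ≤ dist y x := dist_nonneg
  have a1 : φ y * |v y - v x| ≤ (φ x * L + ε) * dist y x := by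
    calc φ y * |v y - v x| ≤ φ y * ((L + ε / 2) * dist y x) :=
          mul_le_mul_of_nonneg_left hy1 (h0 y)
      _ = (φ y * (L + ε / 2)) * dist y x := by ring
      _ ≤ _ := mul_le_mul_of_nonneg_right hy2.le hd
  have a2 : |φ y - φ x| * |v x - c| ≤ (C * dist y x) * |v x - c| :=
    mul_le_mul_of_nonneg_right hφ' (abs_nonneg _)
  nlinarith

lemma glue {X : Type*} [MetricSpace X] {p : ℝ} (hp : 1 ≤ p) {A : Set X} (hA : IsOpen A)
    (c : ℕ → X) (r : ℕ → ℝ)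
    (O : ℕ → Set X) (hO : ∀ k, IsOpen (O k))
    (hcO : ∀ k, closedBall (c k) (r k) ⊆ O k)
    (hcov : ∀ x ∈ A, ∃ j, x ∈ ball (c j) (r j / 2))
    (φ : ℕ → X → ℝ) (C : ℕ → ℝ≥0) (hC : ∀ k, 1 ≤ C k) (hφL : ∀ k, LipschitzWith (C k) (φ k))
    (hφ0 : ∀ k x, 0 ≤ φ k x) (hφ1 : ∀ k x, φ k x ≤ 1)
    (hφs : ∀ k x, x ∉ closedBall (c k) (r k) → φ k x = 0)
    (hφsum : ∀ j, ∀ x ∈ ball (c j) (r j / 2), ∑ k ∈ Finset.range (j + 1), φ k x = 1)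
    (hφz : ∀ j, ∀ x ∈ ball (c j) (r j / 2), ∀ k, j < k → φ k x = 0)
    (v : ℕ → X → ℝ) (hv : ∀ k, LocLipschitzOn (O k) (v k)) (u : X → ℝ) :
    ∃ w : X → ℝ, LocLipschitzOn A w ∧
      (∀ x ∈ A, lipAt A w x ≤
        (∑' k, ENNReal.ofReal (φ k x) * (lipAt (O k) (v k) x) ^ p) ^ (1 / p) +
        ∑' k, (closedBall (c k) (r k)).indicator
          (fun x => (C k : ℝ≥0∞) * ENNReal.ofReal |v k x - u x|) x) ∧
      (∀ x ∈ A, ENNReal.ofReal |w x - u x| ≤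
        ∑' k, (closedBall (c k) (r k)).indicator
          (fun x => (C k : ℝ≥0∞) * ENNReal.ofReal |v k x - u x|) x) := by
  have hp0 : 0 < p := by linarith
  let w : X → ℝ := fun x => ∑' k, φ k x * v k x
  have hw : ∀ j, ∀ x ∈ ball (c j) (r j / 2), w x = ∑ k ∈ Finset.range (j + 1), φ k x * v k x := by
    intro j x hx
    refine tsum_eq_sum fun k hk => ?_
    rw [hφz j x hx k (by simpa using hk), zero_mul]
  have hind : ∀ k x, 0 ≤ (closedBall (c k) (r k)).indicator
      (fun x => (C k : ℝ) * |v k x - u x|) x := by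
    intro k x
    exact indicator_nonneg (fun x _ => by positivity) x
  have hindE : ∀ k x, ENNReal.ofReal ((closedBall (c k) (r k)).indicator
      (fun x => (C k : ℝ) * |v k x - u x|) x) = (closedBall (c k) (r k)).indicator
          (fun x => (C k : ℝ≥0∞) * ENNReal.ofReal |v k x - u x|) x := by
    intro k x
    by_cases hx : x ∈ closedBall (c k) (r k)
    · rw [indicator_of_mem hx, indicator_of_mem hx, ENNReal.ofReal_mul (by positivity),
        ENNReal.ofReal_coe_nnreal]
    · rw [indicator_of_notMem hx, indicator_of_notMem hx, ENNReal.ofReal_zero]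
  refine ⟨w, ?_, ?_, ?_⟩
  · refine locLipschitzOn_of hA fun x hx => ?_
    obtain ⟨j, hj⟩ := hcov x hx
    have hk : ∀ k, ∃ K : ℝ≥0, ∃ t ∈ 𝓝 x, LipschitzOnWith K (fun y => φ k y * v k y) t := by
      intro k
      by_cases hxk : x ∈ O k
      · obtain ⟨s, hs, K, -, hK⟩ := hv k x hxk
        exact lipschitzOn_mul_near (hφL k) (fun y => abs_le.2 ⟨by linarith [hφ0 k y], hφ1 k y⟩)
          ⟨K, _, closedBall_mem_nhds x hs, hK⟩
      · refine ⟨0, (closedBall (c k) (r k))ᶜ,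
          isClosed_closedBall.isOpen_compl.mem_nhds fun h => hxk (hcO k h), ?_⟩
        refine LipschitzOnWith.of_dist_le_mul fun y hy z hz => ?_
        simp [hφs k y hy, hφs k z hz]
    obtain ⟨K, t, ht, hK⟩ := lipschitzOn_sum_near hk (j + 1)
    refine ⟨K, t ∩ ball (c j) (r j / 2), Filter.inter_mem ht (isOpen_ball.mem_nhds hj), ?_⟩
    refine LipschitzOnWith.of_dist_le_mul fun y hy z hz => ?_
    rw [hw j y hy.2, hw j z hz.2]
    exact hK.dist_le_mul y hy.1 z hz.1
  · intro x hx
    obtain ⟨j, hj⟩ := hcov x hx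
    have hterm : ∀ k, ∀ ε > 0, ∀ᶠ y in 𝓝 x,
        |φ k y * v k y - φ k x * v k x - (φ k y - φ k x) * u x| ≤
        (φ k x * (lipAt (O k) (v k) x).toReal + (closedBall (c k) (r k)).indicator
          (fun x => (C k : ℝ) * |v k x - u x|) x + ε) * dist y x := by
      intro k ε hε
      by_cases hxk : x ∈ closedBall (c k) (r k)
      · rw [indicator_of_mem hxk]
        exact glue_term (hO k) (hφL k) (hφ0 k) (hφ1 k) (hv k) (hcO k hxk) (u x) hε
      · filter_upwards [isClosed_closedBall.isOpen_compl.mem_nhds hxk] with y hy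
        rw [indicator_of_notMem hxk, hφs k x hxk, hφs k y hy]
        simp only [zero_mul, sub_self, abs_zero, zero_add]
        positivity
    have hle : lipAt A w x ≤ ENNReal.ofReal (∑ k ∈ Finset.range (j + 1),
        (φ k x * (lipAt (O k) (v k) x).toReal + (closedBall (c k) (r k)).indicator
          (fun x => (C k : ℝ) * |v k x - u x|) x)) := by
      refine lipAt_le (hA.mem_nhds hx) fun ε hε => ?_
      have hε' : 0 < ε / ((j:ℝ) + 1) := by positivity
      have hall : ∀ᶠ y in 𝓝 x, ∀ k ∈ Finset.range (j + 1),
          |φ k y * v k y - φ k x * v k x - (φ k y - φ k x) * u x| ≤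
          (φ k x * (lipAt (O k) (v k) x).toReal + (closedBall (c k) (r k)).indicator
          (fun x => (C k : ℝ) * |v k x - u x|) x + ε / ((j:ℝ) + 1)) * dist y x :=
        (Filter.eventually_all_finset _).2 fun k _ => hterm k _ hε'
      filter_upwards [hall, isOpen_ball.mem_nhds hj] with y hy hyj
      have e : w y - w x = ∑ k ∈ Finset.range (j + 1),
          (φ k y * v k y - φ k x * v k x - (φ k y - φ k x) * u x) := by
        rw [Finset.sum_sub_distrib, Finset.sum_sub_distrib, ← Finset.sum_mul,
          Finset.sum_sub_distrib, hφsum j y hyj, hφsum j x hj, hw j y hyj, hw j x hj]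
        ring
      rw [e]
      refine (Finset.abs_sum_le_sum_abs _ _).trans ((Finset.sum_le_sum hy).trans ?_)
      rw [← Finset.sum_mul, Finset.sum_add_distrib]
      apply le_of_eq
      congr 2
      rw [Finset.sum_const, Finset.card_range, nsmul_eq_mul]
      push_cast
      field_simp
    refine hle.trans ?_
    rw [Finset.sum_add_distrib, ENNReal.ofReal_add
      (Finset.sum_nonneg fun k _ => mul_nonneg (hφ0 k x) ENNReal.toReal_nonneg)
      (Finset.sum_nonneg fun k _ => hind k x)]
    refine add_le_add ?_ ?_
    · rw [one_div, ENNReal.le_rpow_inv_iff hp0, ENNReal.ofReal_sum_of_nonneg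
        fun k _ => mul_nonneg (hφ0 k x) ENNReal.toReal_nonneg]
      have hsumE : ∑ k ∈ Finset.range (j + 1), ENNReal.ofReal (φ k x) = 1 := by
        rw [← ENNReal.ofReal_sum_of_nonneg fun k _ => hφ0 k x, hφsum j x hj, ENNReal.ofReal_one]
      calc (∑ k ∈ Finset.range (j + 1), ENNReal.ofReal (φ k x * (lipAt (O k) (v k) x).toReal)) ^ p
          ≤ (∑ k ∈ Finset.range (j + 1), ENNReal.ofReal (φ k x) * lipAt (O k) (v k) x) ^ p := by
            refine ENNReal.rpow_le_rpow (Finset.sum_le_sum fun k _ => ?_) hp0.le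
            rw [ENNReal.ofReal_mul (hφ0 k x)]
            exact mul_le_mul_right ENNReal.ofReal_toReal_le _
        _ ≤ ∑ k ∈ Finset.range (j + 1), ENNReal.ofReal (φ k x) * (lipAt (O k) (v k) x) ^ p :=
            ENNReal.rpow_arith_mean_le_arith_mean_rpow _ _ _ hsumE hp
        _ ≤ _ := ENNReal.sum_le_tsum _
    · rw [ENNReal.ofReal_sum_of_nonneg fun k _ => hind k x]
      simp only [hindE]
      exact ENNReal.sum_le_tsum _
  · intro x hx
    obtain ⟨j, hj⟩ := hcov x hx
    have e : w x - u x = ∑ k ∈ Finset.range (j + 1), φ k x * (v k x - u x) := by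
      simp only [mul_sub]
      rw [Finset.sum_sub_distrib, ← Finset.sum_mul, hφsum j x hj, hw j x hj]
      ring
    have hb : |w x - u x| ≤ ∑ k ∈ Finset.range (j + 1), (closedBall (c k) (r k)).indicator
          (fun x => (C k : ℝ) * |v k x - u x|) x := by
      rw [e]
      refine (Finset.abs_sum_le_sum_abs _ _).trans (Finset.sum_le_sum fun k _ => ?_)
      by_cases hxk : x ∈ closedBall (c k) (r k)
      · rw [indicator_of_mem hxk, abs_mul, abs_of_nonneg (hφ0 k x)]
        refine mul_le_mul_of_nonneg_right ((hφ1 k x).trans ?_) (abs_nonneg _)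
        exact_mod_cast hC k
      · rw [hφs k x hxk, indicator_of_notMem hxk]
        simp
    refine (ENNReal.ofReal_le_ofReal hb).trans ?_
    rw [ENNReal.ofReal_sum_of_nonneg fun k _ => hind k x]
    simp only [hindE]
    exact ENNReal.sum_le_tsum _

lemma diag {X : Type*} [MetricSpace X] [MeasurableSpace X] [BorelSpace X] (m : Measure X)
    {p : ℝ} {O : Set X} (hO : IsOpen O) (φ : ℕ → X → ℝ)
    (hφc : ∀ k, Continuous (φ k)) (hφ0 : ∀ k x, 0 ≤ φ k x)
    (hφsum : ∀ n x, ∑ k ∈ Finset.range n, φ k x ≤ 1)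
    (v : ℕ → X → ℝ) (hv : ∀ n, LocLipschitzOn O (v n)) (δ : ℝ≥0∞)
    (hδ : ∀ n, ∫⁻ x in O, lipAt O (v n) x ^ p ∂m ≤ δ) :
    ∃ σ : ℕ → ℕ, StrictMono σ ∧ ∃ a : ℕ → ℝ≥0∞,
      (∀ k, Tendsto (fun n => ∫⁻ x in O, ENNReal.ofReal (φ k x) * lipAt O (v (σ n)) x ^ p ∂m)
        atTop (𝓝 (a k))) ∧ ∑' k, a k ≤ δ := by
  obtain ⟨a, σ, hσ, ha⟩ := CompactSpace.tendsto_subseq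
    (fun n : ℕ => fun k : ℕ => ∫⁻ x in O, ENNReal.ofReal (φ k x) * lipAt O (v n) x ^ p ∂m)
  have ha' := tendsto_pi_nhds.1 ha
  refine ⟨σ, hσ, a, ha', ENNReal.tsum_le_of_sum_range_le fun N => ?_⟩
  refine le_of_tendsto' (tendsto_finsetSum (Finset.range N) fun k _ => ha' k) fun n => ?_
  have hmeas : AEMeasurable (lipAt O (v (σ n))) (m.restrict O) := by
    have h1 := (measurable_lipAt hO (hv (σ n)).continuousOn).aemeasurable (μ := m.restrict O)
    exact h1.congr (indicator_ae_eq_restrict hO.measurableSet)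
  simp only [Function.comp]
  have hmk : ∀ k ∈ Finset.range N, AEMeasurable
      (fun x => ENNReal.ofReal (φ k x) * lipAt O (v (σ n)) x ^ p) (m.restrict O) := fun k _ =>
    ((hφc k).measurable.ennreal_ofReal.aemeasurable).mul (hmeas.pow_const p)
  rw [← lintegral_finsetSum' _ hmk]
  refine le_trans (lintegral_mono fun x => ?_) (hδ (σ n))
  rw [← Finset.sum_mul, ← ENNReal.ofReal_sum_of_nonneg fun k _ => hφ0 k x]
  refine mul_le_of_le_one_left (zero_le) ?_
  rw [ENNReal.ofReal_le_one]
  exact hφsum N x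

lemma approx {X : Type*} [MetricSpace X] [TopologicalSpace.SeparableSpace X] [MeasurableSpace X]
    [BorelSpace X] (m : Measure X) {p : ℝ} (hp : 1 ≤ p) {u : X → ℝ} (hu : Measurable u)
    (A : ℕ → Set X) (hA : ∀ i, IsOpen (A i)) (hne : (⋃ i, A i).Nonempty)
    (v : ℕ → ℕ → X → ℝ) (hv : ∀ i n, LocLipschitzOn (A i) (v i n))
    (ht : ∀ i, TendstoLpLoc m p (A i) (v i) u) (δ : ℕ → ℝ≥0∞)
    (hδ : ∀ i n, ∫⁻ x in A i, lipAt (A i) (v i n) x ^ p ∂m ≤ δ i) (ε : ℝ≥0∞) (hε : ε ≠ 0) :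
    ∃ w : X → ℝ, LocLipschitzOn (⋃ i, A i) w ∧
      ∫⁻ x in ⋃ i, A i, lipAt (⋃ i, A i) w x ^ p ∂m ≤ ((∑' i, δ i + ε) ^ (1 / p) + ε) ^ p ∧
      ∫⁻ x in ⋃ i, A i, ENNReal.ofReal |w x - u x| ^ p ∂m ≤ ε ^ p := by
  have hp0 : 0 < p := by linarith
  have : SecondCountableTopology X := UniformSpace.secondCountable_of_separable X
  have hUA : IsOpen (⋃ i, A i) := isOpen_iUnion hA
  have h1 : ∀ x : ↥(⋃ i, A i), ∃ i, ∃ r : ℝ, 0 < r ∧ closedBall (x : X) r ⊆ A i ∧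
      Tendsto (fun n => ∫⁻ x' in closedBall (x : X) r, ENNReal.ofReal |v i n x' - u x'| ^ p ∂m)
        atTop (𝓝 0) := by
    rintro ⟨x, hx⟩
    obtain ⟨i, hi⟩ := mem_iUnion.1 hx
    obtain ⟨r, hr, hrt⟩ := ht i x hi
    obtain ⟨s, hs, hsub⟩ := Metric.nhds_basis_closedBall.mem_iff.1 ((hA i).mem_nhds hi)
    refine ⟨i, min r s, lt_min hr hs, (closedBall_subset_closedBall (min_le_right _ _)).trans hsub,
      ?_⟩
    refine tendsto_of_tendsto_of_tendsto_of_le_of_le tendsto_const_nhds hrt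
      (fun n => zero_le) fun n => ?_
    refine lintegral_mono_set (subset_inter ?_ ?_)
    · exact (closedBall_subset_closedBall (min_le_right _ _)).trans hsub
    · exact closedBall_subset_closedBall (min_le_left _ _)
  choose ix rx hrx hsubx htx using h1
  obtain ⟨T, hTc, hT⟩ := TopologicalSpace.isOpen_iUnion_countable
    (fun x : ↥(⋃ i, A i) => ball (x : X) (rx x / 2)) fun x => isOpen_ball
  have hcovT : ∀ x ∈ ⋃ i, A i, ∃ y ∈ T, x ∈ ball (y : X) (rx y / 2) := by
    intro x hx
    have : x ∈ ⋃ y : ↥(⋃ i, A i), ball (y : X) (rx y / 2) :=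
      mem_iUnion.2 ⟨⟨x, hx⟩, mem_ball_self (half_pos (hrx _))⟩
    rw [← hT] at this
    simpa only [mem_iUnion, exists_prop] using this
  have hTne : T.Nonempty := by
    obtain ⟨x, hx⟩ := hne
    obtain ⟨y, hy, -⟩ := hcovT x hx
    exact ⟨y, hy⟩
  obtain ⟨e, he⟩ := hTc.exists_eq_range hTne
  have hcov : ∀ x ∈ ⋃ i, A i, ∃ j, x ∈ ball (e j : X) (rx (e j) / 2) := by
    intro x hx
    obtain ⟨y, hy, hxy⟩ := hcovT x hx
    rw [he] at hy
    obtain ⟨j, rfl⟩ := hy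
    exact ⟨j, hxy⟩
  obtain ⟨φ, C, hC, hφL, hφ0, hφ1, hφs, hφsum1, hφsum, hφz⟩ :=
    exists_pou (fun k => (e k : X)) (fun k => rx (e k)) (fun k => hrx _)
  choose σ hσ a ha hasum using fun i => diag m (hA i) φ (fun k => (hφL k).continuous) hφ0 hφsum1
    (v i) (hv i) (δ i) (hδ i)
  obtain ⟨η, hη0, hηsum⟩ := ENNReal.exists_pos_sum_of_countable' hε ℕ
  have hpick : ∀ k, ∃ n : ℕ,
      (C k : ℝ≥0∞) ^ p * ∫⁻ x in closedBall (e k : X) (rx (e k)),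
        ENNReal.ofReal |v (ix (e k)) (σ (ix (e k)) n) x - u x| ^ p ∂m ≤ η k ^ p ∧
      ∫⁻ x in A (ix (e k)), ENNReal.ofReal (φ k x) *
        lipAt (A (ix (e k))) (v (ix (e k)) (σ (ix (e k)) n)) x ^ p ∂m ≤ a (ix (e k)) k + η k := by
    intro k
    have t1 := ((htx (e k)).comp (hσ (ix (e k))).tendsto_atTop)
    have t2 := ENNReal.Tendsto.const_mul (a := (C k : ℝ≥0∞) ^ p) t1
      (Or.inr (ENNReal.rpow_ne_top_of_nonneg hp0.le ENNReal.coe_ne_top))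
    rw [mul_zero] at t2
    have e1 := t2.eventually_lt_const (ENNReal.rpow_pos_of_nonneg (hη0 k) hp0.le)
    have e2 : ∀ᶠ n in atTop, ∫⁻ x in A (ix (e k)), ENNReal.ofReal (φ k x) *
        lipAt (A (ix (e k))) (v (ix (e k)) (σ (ix (e k)) n)) x ^ p ∂m
        ≤ a (ix (e k)) k + η k := by
      by_cases htop : a (ix (e k)) k = ⊤
      · exact Filter.Eventually.of_forall fun n => by simp [htop]
      · have := (ha (ix (e k)) k).eventually_lt_const (ENNReal.lt_add_right htop (hη0 k).ne')
        exact this.mono fun n hn => hn.le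
    obtain ⟨n, hn1, hn2⟩ := (e1.and e2).exists
    exact ⟨n, hn1.le, hn2⟩
  choose n hn1 hn2 using hpick
  let O : ℕ → Set X := fun k => A (ix (e k))
  let V : ℕ → X → ℝ := fun k => v (ix (e k)) (σ (ix (e k)) (n k))
  have hO : ∀ k, IsOpen (O k) := fun k => hA _
  have hVL : ∀ k, LocLipschitzOn (O k) (V k) := fun k => hv _ _
  have hcO : ∀ k, closedBall (e k : X) (rx (e k)) ⊆ O k := fun k => hsubx (e k)
  obtain ⟨w, hwL, hwlip, hwu⟩ := glue hp hUA (fun k => (e k : X)) (fun k => rx (e k)) O hO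
    hcO hcov φ C hC hφL hφ0 hφ1 hφs hφsum hφz V hVL u
  -- the error term
  set g : ℕ → X → ℝ≥0∞ := fun k => (closedBall (e k : X) (rx (e k))).indicator
    (fun x => (C k : ℝ≥0∞) * ENNReal.ofReal |V k x - u x|) with hg
  have hgm : ∀ k, Measurable (g k) := by
    intro k
    classical
    have hm1 : Measurable ((closedBall (e k : X) (rx (e k))).piecewise (V k) (fun _ => 0)) :=
      ((hVL k).continuousOn.mono (hcO k)).measurable_piecewise continuousOn_const
        isClosed_closedBall.measurableSet
    have hm2 : Measurable ((closedBall (e k : X) (rx (e k))).indicator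
      (fun x => (C k : ℝ≥0∞) * ENNReal.ofReal
        |(closedBall (e k : X) (rx (e k))).piecewise (V k) (fun _ => 0) x - u x|)) := by
      refine Measurable.indicator ?_ isClosed_closedBall.measurableSet
      refine Measurable.const_mul ?_ _
      exact (measurable_norm.comp (hm1.sub hu)).ennreal_ofReal
    convert hm2 using 1
    refine indicator_congr fun x hx => ?_
    rw [piecewise_eq_of_mem _ _ _ hx]
  have hgk : ∀ k, (∫⁻ x in ⋃ i, A i, g k x ^ p ∂m) ^ (1 / p) ≤ η k := by
    intro k
    rw [one_div, ENNReal.rpow_inv_le_iff hp0]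
    refine le_trans ?_ (hn1 k)
    rw [← lintegral_const_mul' _ _ (ENNReal.rpow_ne_top_of_nonneg hp0.le ENNReal.coe_ne_top),
      ← lintegral_indicator isClosed_closedBall.measurableSet]
    refine (setLIntegral_le_lintegral _ _).trans (lintegral_mono fun x => ?_)
    simp only [hg]
    by_cases hx : x ∈ closedBall (e k : X) (rx (e k))
    · rw [indicator_of_mem hx, indicator_of_mem hx, ENNReal.mul_rpow_of_nonneg _ _ hp0.le]
    · rw [indicator_of_notMem hx, indicator_of_notMem hx, ENNReal.zero_rpow_of_pos hp0]
  have hG : ∫⁻ x in ⋃ i, A i, (∑' k, g k x) ^ p ∂m ≤ ε ^ p := by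
    refine (lintegral_tsum_rpow_le _ hp hgm).trans (ENNReal.rpow_le_rpow ?_ hp0.le)
    exact (ENNReal.tsum_le_tsum hgk).trans hηsum.le
  -- the main term
  set H : ℕ → X → ℝ≥0∞ := fun k x => ENNReal.ofReal (φ k x) * (lipAt (O k) (V k) x) ^ p with hH
  have hHi : ∀ k, H k = (O k).indicator (H k) := by
    intro k
    funext x
    by_cases hx : x ∈ O k
    · rw [indicator_of_mem hx]
    · rw [indicator_of_notMem hx]
      simp [hH, hφs k x fun h => hx (hcO k h)]
  have hHm : ∀ k, Measurable (H k) := by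
    intro k
    have : H k = fun x => ENNReal.ofReal (φ k x) * ((O k).indicator (lipAt (O k) (V k)) x) ^ p := by
      funext x
      by_cases hx : x ∈ O k
      · simp only [hH]
        rw [indicator_of_mem hx]
      · simp [hH, hφs k x fun h => hx (hcO k h)]
    rw [this]
    exact (hφL k).continuous.measurable.ennreal_ofReal.mul
      ((measurable_lipAt (hO k) (hVL k).continuousOn).pow_const p)
  have hHint : ∀ k, ∫⁻ x in ⋃ i, A i, H k x ∂m ≤ a (ix (e k)) k + η k := by
    intro k
    refine le_trans ?_ (hn2 k)
    refine (setLIntegral_le_lintegral _ _).trans ?_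
    rw [hHi k, lintegral_indicator (hO k).measurableSet]
  have hF : ∫⁻ x in ⋃ i, A i, ∑' k, H k x ∂m ≤ ∑' i, δ i + ε := by
    rw [lintegral_tsum fun k => (hHm k).aemeasurable]
    refine (ENNReal.tsum_le_tsum hHint).trans ?_
    rw [ENNReal.tsum_add]
    refine add_le_add ?_ hηsum.le
    calc ∑' k, a (ix (e k)) k ≤ ∑' k, ∑' i, a i k :=
          ENNReal.tsum_le_tsum fun k => ENNReal.le_tsum (f := fun i => a i k) (ix (e k))
      _ = ∑' i, ∑' k, a i k := ENNReal.tsum_comm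
      _ ≤ ∑' i, δ i := ENNReal.tsum_le_tsum hasum
  refine ⟨w, hwL, ?_, ?_⟩
  · have s1 : ∫⁻ x in ⋃ i, A i, lipAt (⋃ i, A i) w x ^ p ∂m ≤
        ∫⁻ x in ⋃ i, A i, ((fun x => (∑' k, H k x) ^ (1 / p)) + (fun x => ∑' k, g k x)) x ^ p ∂m :=
      setLIntegral_mono' hUA.measurableSet fun x hx =>
        ENNReal.rpow_le_rpow (hwlip x hx) hp0.le
    refine s1.trans ?_
    rw [← ENNReal.rpow_inv_le_iff hp0, ← one_div]
    refine (ENNReal.lintegral_Lp_add_le ?_ ?_ hp).trans (add_le_add ?_ ?_)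
    · exact ((Measurable.tsum hHm).pow_const _).aemeasurable
    · exact (Measurable.tsum hgm).aemeasurable
    · refine ENNReal.rpow_le_rpow ?_ (by positivity)
      simpa only [one_div, ENNReal.rpow_inv_rpow hp0.ne'] using hF
    · rw [one_div, ENNReal.rpow_inv_le_iff hp0]
      exact hG
  · refine le_trans ?_ hG
    exact setLIntegral_mono' hUA.measurableSet fun x hx => ENNReal.rpow_le_rpow (hwu x hx) hp0.le

lemma cheegerOpen_empty {X : Type*} [MetricSpace X] [MeasurableSpace X] (m : Measure X) (p : ℝ)
    (u : X → ℝ) : cheegerOpen m p u ∅ = 0 := by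
  refine le_antisymm ?_ (zero_le)
  unfold cheegerOpen
  refine iInf_le_of_le (fun _ => u) (iInf_le_of_le (fun n x hx => hx.elim)
    (iInf_le_of_le (fun x hx => hx.elim) ?_))
  simp

lemma TendstoLpLoc.mono {X : Type*} [MetricSpace X] [MeasurableSpace X] {m : Measure X} {p : ℝ}
    {A B : Set X} {v : ℕ → X → ℝ} {u : X → ℝ} (h : TendstoLpLoc m p B v u) (hAB : A ⊆ B) :
    TendstoLpLoc m p A v u := by
  intro x hx
  obtain ⟨r, hr, ht⟩ := h x (hAB hx)
  refine ⟨r, hr, tendsto_of_tendsto_of_tendsto_of_le_of_le tendsto_const_nhds ht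
      (fun n => zero_le) fun n => ?_⟩
  exact lintegral_mono_set (inter_subset_inter_left _ hAB)

lemma cheegerOpen_superadd {X : Type*} [MetricSpace X] [MeasurableSpace X] [BorelSpace X]
    (m : Measure X) (p : ℝ) (u : X → ℝ) {A B Ω : Set X} (hA : IsOpen A) (hB : IsOpen B)
    (hΩ : IsOpen Ω) (hAΩ : A ⊆ Ω) (hBΩ : B ⊆ Ω) (hAB : Disjoint A B) :
    cheegerOpen m p u A + cheegerOpen m p u B ≤ cheegerOpen m p u Ω := by
  conv_rhs => unfold cheegerOpen
  refine le_iInf fun v => le_iInf fun hv => le_iInf fun ht => ?_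
  have key : ∀ D : Set X, IsOpen D → D ⊆ Ω → cheegerOpen m p u D ≤
      Filter.liminf (fun n => ∫⁻ x in D, lipAt Ω (v n) x ^ p ∂m) atTop := by
    intro D hD hDΩ
    unfold cheegerOpen
    refine iInf_le_of_le v (iInf_le_of_le (fun n => (hv n).mono hD hDΩ)
      (iInf_le_of_le (ht.mono hDΩ) (le_of_eq ?_)))
    congr 1
    funext n
    refine setLIntegral_congr_fun hD.measurableSet fun x hx => ?_
    rw [lipAt_congr (hD.mem_nhds hx) (hΩ.mem_nhds (hDΩ hx))]
  refine (add_le_add (key A hA hAΩ) (key B hB hBΩ)).trans ?_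
  have hsum : ∀ n, ∫⁻ x in A, lipAt Ω (v n) x ^ p ∂m + ∫⁻ x in B, lipAt Ω (v n) x ^ p ∂m
      ≤ ∫⁻ x in Ω, lipAt Ω (v n) x ^ p ∂m := by
    intro n
    rw [← lintegral_union hB.measurableSet hAB]
    exact lintegral_mono_set (union_subset hAΩ hBΩ)
  rw [Filter.liminf_eq_iSup_iInf_of_nat, Filter.liminf_eq_iSup_iInf_of_nat,
    Filter.liminf_eq_iSup_iInf_of_nat]
  refine ENNReal.iSup_add_iSup_le fun i j => ?_
  refine le_iSup_of_le (max i j) (le_iInf₂ fun n hn => ?_)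
  refine le_trans (add_le_add ?_ ?_) (hsum n)
  · exact iInf₂_le n ((le_max_left i j).trans hn)
  · exact iInf₂_le n ((le_max_right i j).trans hn)

lemma cheegerOpen_iUnion_le {X : Type*} [MetricSpace X] [TopologicalSpace.SeparableSpace X]
    [MeasurableSpace X] [BorelSpace X] (m : Measure X) {p : ℝ} (hp : 1 ≤ p) {u : X → ℝ}
    (hu : Measurable u) (A : ℕ → Set X) (hA : ∀ i, IsOpen (A i)) :
    cheegerOpen m p u (⋃ i, A i) ≤ ∑' i, cheegerOpen m p u (A i) := by
  have hp0 : 0 < p := by linarith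
  rcases (⋃ i, A i).eq_empty_or_nonempty with hemp | hne
  · rw [hemp, cheegerOpen_empty]
    exact zero_le
  set S := ∑' i, cheegerOpen m p u (A i) with hS
  by_cases htop : S = ⊤
  · rw [htop]
    exact le_top
  have hfin : ∀ i, cheegerOpen m p u (A i) ≠ ⊤ := ENNReal.ne_top_of_tsum_ne_top htop
  have step : ∀ ε : ℝ≥0∞, ε ≠ 0 → ∃ w : X → ℝ, LocLipschitzOn (⋃ i, A i) w ∧
      ∫⁻ x in ⋃ i, A i, lipAt (⋃ i, A i) w x ^ p ∂m ≤ ((S + ε + ε) ^ (1 / p) + ε) ^ p ∧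
      ∫⁻ x in ⋃ i, A i, ENNReal.ofReal |w x - u x| ^ p ∂m ≤ ε ^ p := by
    intro ε hε
    obtain ⟨η, hη0, hηsum⟩ := ENNReal.exists_pos_sum_of_countable' hε ℕ
    have hseq : ∀ i, ∃ v : ℕ → X → ℝ, (∀ n, LocLipschitzOn (A i) (v n)) ∧
        TendstoLpLoc m p (A i) v u ∧
        ∀ n, ∫⁻ x in A i, lipAt (A i) (v n) x ^ p ∂m ≤ cheegerOpen m p u (A i) + η i := by
      intro i
      have hlt : cheegerOpen m p u (A i) < cheegerOpen m p u (A i) + η i :=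
        ENNReal.lt_add_right (hfin i) (hη0 i).ne'
      set d := cheegerOpen m p u (A i) + η i
      unfold cheegerOpen at hlt
      simp only [iInf_lt_iff] at hlt
      obtain ⟨v, hv, ht, hlim⟩ := hlt
      have hfreq := Filter.frequently_lt_of_liminf_lt (by isBoundedDefault) hlim
      obtain ⟨σ, hσ, hσd⟩ := Filter.extraction_of_frequently_atTop hfreq
      refine ⟨fun n => v (σ n), fun n => hv _, fun x hx => ?_, fun n => (hσd n).le⟩
      obtain ⟨r, hr, hrt⟩ := ht x hx
      exact ⟨r, hr, hrt.comp hσ.tendsto_atTop⟩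
    choose v hv ht hd using hseq
    obtain ⟨w, h1, h2, h3⟩ := approx m hp hu A hA hne v hv ht _ hd ε hε
    refine ⟨w, h1, h2.trans ?_, h3⟩
    have : ∑' i, (cheegerOpen m p u (A i) + η i) ≤ S + ε := by
      rw [ENNReal.tsum_add]
      exact add_le_add le_rfl hηsum.le
    refine ENNReal.rpow_le_rpow (add_le_add ?_ le_rfl) hp0.le
    exact ENNReal.rpow_le_rpow (add_le_add this le_rfl) (by positivity)
  choose w hwL hwlip hwu using fun n : ℕ => step ((n : ℝ≥0∞)⁻¹) (by simp)
  have hε : Tendsto (fun n : ℕ => (n : ℝ≥0∞)⁻¹) atTop (𝓝 0) :=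
    ENNReal.tendsto_inv_nat_nhds_zero
  have hlim : Tendsto (fun n : ℕ => ((S + (n : ℝ≥0∞)⁻¹ + (n : ℝ≥0∞)⁻¹) ^ (1 / p) +
      (n : ℝ≥0∞)⁻¹) ^ p) atTop (𝓝 S) := by
    have hc : Continuous fun t : ℝ≥0∞ => ((S + t + t) ^ (1 / p) + t) ^ p := by
      refine ENNReal.continuous_rpow_const.comp ?_
      refine (ENNReal.continuous_rpow_const.comp ?_).add continuous_id
      exact (continuous_const.add continuous_id).add continuous_id
    have := (hc.tendsto 0).comp hε
    have e : ((S + 0 + 0) ^ (1 / p) + 0) ^ p = S := by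
      rw [add_zero, add_zero, add_zero, one_div, ENNReal.rpow_inv_rpow hp0.ne']
    rw [e] at this
    exact this
  have htd : TendstoLpLoc m p (⋃ i, A i) w u := by
    intro x hx
    refine ⟨1, one_pos, ?_⟩
    have h0 : Tendsto (fun n : ℕ => ((n : ℝ≥0∞)⁻¹) ^ p) atTop (𝓝 0) := by
      have := ((ENNReal.continuous_rpow_const (y := p)).tendsto 0).comp hε
      rw [ENNReal.zero_rpow_of_pos hp0] at this
      exact this
    refine tendsto_of_tendsto_of_tendsto_of_le_of_le tendsto_const_nhds h0
      (fun n => zero_le) fun n => ?_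
    exact (lintegral_mono_set inter_subset_left).trans (hwu n)
  unfold cheegerOpen
  refine iInf_le_of_le w (iInf_le_of_le hwL (iInf_le_of_le htd ?_))
  rw [← hlim.liminf_eq]
  exact Filter.liminf_le_liminf (Filter.Eventually.of_forall hwlip)

lemma cheegerSet_le {X : Type*} [MetricSpace X] [MeasurableSpace X] (m : Measure X) (p : ℝ)
    {Ω : Set X} (u : X → ℝ) {S Ω' : Set X} (h : IsOpen Ω') (h1 : Ω' ⊆ Ω) (h2 : S ⊆ Ω') :
    cheegerSet m p Ω u S ≤ cheegerOpen m p u Ω' :=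
  iInf_le_of_le Ω' (iInf_le_of_le h (iInf_le_of_le h1 (iInf_le_of_le h2 le_rfl)))

lemma cheegerSet_mono {X : Type*} [MetricSpace X] [MeasurableSpace X] (m : Measure X) (p : ℝ)
    (Ω : Set X) (u : X → ℝ) {S T : Set X} (h : S ⊆ T) :
    cheegerSet m p Ω u S ≤ cheegerSet m p Ω u T :=
  le_iInf fun _ => le_iInf fun h1 => le_iInf fun h2 => le_iInf fun h3 =>
    cheegerSet_le m p u h1 h2 (h.trans h3)

lemma cheegerSet_empty {X : Type*} [MetricSpace X] [MeasurableSpace X] (m : Measure X) (p : ℝ)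
    (Ω : Set X) (u : X → ℝ) : cheegerSet m p Ω u ∅ = 0 := by
  refine le_antisymm ?_ (zero_le)
  refine (cheegerSet_le m p u isOpen_empty (empty_subset _) le_rfl).trans ?_
  rw [cheegerOpen_empty]

lemma exists_open_of_cheegerSet_lt {X : Type*} [MetricSpace X] [MeasurableSpace X]
    {m : Measure X} {p : ℝ} {Ω : Set X} {u : X → ℝ} {S : Set X} {d : ℝ≥0∞}
    (h : cheegerSet m p Ω u S < d) :
    ∃ U, IsOpen U ∧ U ⊆ Ω ∧ S ⊆ U ∧ cheegerOpen m p u U < d := by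
  unfold cheegerSet at h
  simp only [iInf_lt_iff] at h
  obtain ⟨U, h1, h2, h3, h4⟩ := h
  exact ⟨U, h1, h2, h3, h4⟩

lemma cheegerSet_iUnion_le {X : Type*} [MetricSpace X] [TopologicalSpace.SeparableSpace X]
    [MeasurableSpace X] [BorelSpace X] (m : Measure X) {p : ℝ} (hp : 1 ≤ p) (Ω : Set X) {u : X → ℝ}
    (hu : Measurable u) (s : ℕ → Set X) :
    cheegerSet m p Ω u (⋃ n, s n) ≤ ∑' n, cheegerSet m p Ω u (s n) := by
  by_cases htop : ∑' n, cheegerSet m p Ω u (s n) = ⊤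
  · rw [htop]
    exact le_top
  have hfin : ∀ i, cheegerSet m p Ω u (s i) ≠ ⊤ := ENNReal.ne_top_of_tsum_ne_top htop
  refine ENNReal.le_of_forall_pos_le_add fun ε hε _ => ?_
  obtain ⟨η, hη0, hηsum⟩ := ENNReal.exists_pos_sum_of_countable'
    (ENNReal.coe_ne_zero.2 hε.ne') ℕ
  choose U hU hUΩ hsU hlt using fun i => exists_open_of_cheegerSet_lt
    (ENNReal.lt_add_right (hfin i) (hη0 i).ne')
  calc cheegerSet m p Ω u (⋃ n, s n) ≤ cheegerOpen m p u (⋃ n, U n) :=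
        cheegerSet_le m p u (isOpen_iUnion hU) (iUnion_subset hUΩ) (iUnion_mono hsU)
    _ ≤ ∑' n, cheegerOpen m p u (U n) := cheegerOpen_iUnion_le m hp hu U hU
    _ ≤ ∑' n, (cheegerSet m p Ω u (s n) + η n) := ENNReal.tsum_le_tsum fun n => (hlt n).le
    _ = ∑' n, cheegerSet m p Ω u (s n) + ∑' n, η n := ENNReal.tsum_add
    _ ≤ _ := add_le_add le_rfl hηsum.le

/-- The Cheeger energy, as an outer measure on the whole space, concentrated on `Ω`. -/
def cheegerOM {X : Type*} [MetricSpace X] [TopologicalSpace.SeparableSpace X]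
    [MeasurableSpace X] [BorelSpace X] (m : Measure X) {p : ℝ} (hp : 1 ≤ p) (Ω : Set X) {u : X → ℝ}
    (hu : Measurable u) : OuterMeasure X where
  measureOf S := cheegerSet m p Ω u (S ∩ Ω)
  empty := by rw [empty_inter, cheegerSet_empty]
  mono h := cheegerSet_mono m p Ω u (inter_subset_inter_left _ h)
  iUnion_nat s _ := by
    rw [iUnion_inter]
    exact cheegerSet_iUnion_le m hp Ω hu _

lemma cheegerOM_isMetric {X : Type*} [MetricSpace X] [TopologicalSpace.SeparableSpace X]
    [MeasurableSpace X] [BorelSpace X] (m : Measure X) {p : ℝ} (hp : 1 ≤ p) (Ω : Set X) {u : X → ℝ}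
    (hu : Measurable u) : (cheegerOM m hp Ω hu).IsMetric := by
  intro S T hST
  refine le_antisymm (measure_union_le S T) ?_
  show cheegerSet m p Ω u (S ∩ Ω) + cheegerSet m p Ω u (T ∩ Ω) ≤
    cheegerSet m p Ω u ((S ∪ T) ∩ Ω)
  obtain ⟨r, hr0, hr⟩ := hST
  have hr2 : 0 < r / 2 := ENNReal.half_pos hr0
  refine le_iInf fun Ω' => le_iInf fun h1 => le_iInf fun h2 => le_iInf fun h3 => ?_
  have hop : ∀ Q : Set X, IsOpen (⋃ x ∈ Q, Metric.eball x (r / 2)) := fun Q =>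
    isOpen_biUnion fun x _ => Metric.isOpen_eball
  have hself : ∀ Q : Set X, Q ⊆ ⋃ x ∈ Q, Metric.eball x (r / 2) := fun Q x hx =>
    mem_biUnion hx (Metric.mem_eball_self hr2)
  have hdis : Disjoint (Ω' ∩ ⋃ x ∈ S, Metric.eball x (r / 2))
      (Ω' ∩ ⋃ x ∈ T, Metric.eball x (r / 2)) := by
    rw [Set.disjoint_left]
    rintro z ⟨-, hz1⟩ ⟨-, hz2⟩
    simp only [mem_iUnion, exists_prop, Metric.mem_eball] at hz1 hz2
    obtain ⟨x, hx, hzx⟩ := hz1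
    obtain ⟨y, hy, hzy⟩ := hz2
    have h4 : edist x y < r / 2 + r / 2 := by
      refine (edist_triangle x z y).trans_lt (ENNReal.add_lt_add ?_ hzy)
      rwa [edist_comm]
    rw [ENNReal.add_halves] at h4
    exact absurd (hr x hx y hy) (not_le.2 h4)
  refine le_trans (add_le_add ?_ ?_) (cheegerOpen_superadd m p u (h1.inter (hop S))
    (h1.inter (hop T)) h1 inter_subset_left inter_subset_left hdis)
  · refine cheegerSet_le m p u (h1.inter (hop S)) (inter_subset_left.trans h2) ?_
    exact fun x hx => ⟨h3 ⟨Or.inl hx.1, hx.2⟩, hself S hx.1⟩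
  · refine cheegerSet_le m p u (h1.inter (hop T)) (inter_subset_left.trans h2) ?_
    exact fun x hx => ⟨h3 ⟨Or.inr hx.1, hx.2⟩, hself T hx.1⟩

lemma exists_borel_hull {X : Type*} [MetricSpace X]
    [MeasurableSpace X] [BorelSpace X] (m : Measure X) (p : ℝ) {Ω : Set X} (hΩ : IsOpen Ω)
    (u : X → ℝ) {S : Set X} (hS : S ⊆ Ω) : ∃ B : Set X, B ⊆ Ω ∧ MeasurableSet B ∧ S ⊆ B ∧
      cheegerSet m p Ω u S = cheegerSet m p Ω u B := by
  by_cases htop : cheegerSet m p Ω u S = ⊤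
  · refine ⟨Ω, le_rfl, hΩ.measurableSet, hS, ?_⟩
    have := cheegerSet_mono m p Ω u hS
    rw [htop, top_le_iff] at this
    rw [htop, this]
  choose U hU hUΩ hsU hlt using fun n : ℕ => exists_open_of_cheegerSet_lt
    (ENNReal.lt_add_right (b := (n : ℝ≥0∞)⁻¹) htop (by simp))
  refine ⟨⋂ n, U n, (iInter_subset U 0).trans (hUΩ 0),
    MeasurableSet.iInter fun n => (hU n).measurableSet, subset_iInter hsU,
    le_antisymm (cheegerSet_mono m p Ω u (subset_iInter hsU)) ?_⟩
  have hlim : Tendsto (fun n : ℕ => cheegerSet m p Ω u S + (n : ℝ≥0∞)⁻¹) atTop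
      (𝓝 (cheegerSet m p Ω u S + 0)) :=
    tendsto_const_nhds.add ENNReal.tendsto_inv_nat_nhds_zero
  rw [add_zero] at hlim
  exact ge_of_tendsto' hlim fun n =>
    (cheegerSet_le m p u (hU n) (hUΩ n) (iInter_subset U n)).trans (hlt n).le

end helpers

theorem statement12
    {X : Type*} [MetricSpace X] [TopologicalSpace.SeparableSpace X] [ConnectedSpace X]
    [Nontrivial X] [MeasurableSpace X] [BorelSpace X]
    (hloc : ∀ x : X, ∃ r > 0, IsComplete (closedBall x r))
    (m : Measure X) [IsLocallyFiniteMeasure m] (hm : m ≠ 0)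
    (p : ℝ) (hp : 1 ≤ p)
    (Ω : Set X) (hΩ : IsOpen Ω) (u : X → ℝ) (hu : MemLpLocOn m p Ω u) :
    cheegerSet m p Ω u ∅ = 0 ∧
    (∀ S T : Set X, S ⊆ T → T ⊆ Ω → cheegerSet m p Ω u S ≤ cheegerSet m p Ω u T) ∧
    (∀ s : ℕ → Set X, (∀ n, s n ⊆ Ω) →
      cheegerSet m p Ω u (⋃ n, s n) ≤ ∑' n, cheegerSet m p Ω u (s n)) ∧
    (∀ B : Set X, MeasurableSet B → ∀ S, S ⊆ Ω →
      cheegerSet m p Ω u S = cheegerSet m p Ω u (S ∩ B) + cheegerSet m p Ω u (S \ B)) ∧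
    ∀ S, S ⊆ Ω → ∃ B : Set X, B ⊆ Ω ∧ MeasurableSet B ∧ S ⊆ B ∧
      cheegerSet m p Ω u S = cheegerSet m p Ω u B := by
  refine ⟨cheegerSet_empty m p Ω u, fun S T h _ => cheegerSet_mono m p Ω u h,
    fun s _ => cheegerSet_iUnion_le m hp Ω hu.1 s, ?_, fun S hS => exists_borel_hull m p hΩ u hS⟩
  intro B hB S hS
  have hle := (cheegerOM_isMetric m hp Ω hu.1).borel_le_caratheodory
  have hBc : (cheegerOM m hp Ω hu.1).IsCaratheodory B := by
    have hB' : MeasurableSet[borel X] B := by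
      rw [← BorelSpace.measurable_eq (α := X)]
      exact hB
    exact hle B hB'
  have h := hBc S
  have e1 : S ∩ Ω = S := inter_eq_left.2 hS
  have e2 : S ∩ B ∩ Ω = S ∩ B := inter_eq_left.2 (inter_subset_left.trans hS)
  have e3 : (S \ B) ∩ Ω = S \ B := inter_eq_left.2 (sdiff_subset.trans hS)
  change cheegerSet m p Ω u (S ∩ Ω) = cheegerSet m p Ω u (S ∩ B ∩ Ω) +
    cheegerSet m p Ω u ((S \ B) ∩ Ω) at h
  rw [e1, e2, e3] at h
  exact h

end BBM
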